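/- arXiv:1902.06041 — 4 statements merged into one kernel-verified Lean document; each statement's English description precedes it below -/
import Mathlib

section
/- Assume f is bounded from below on S and let λ ∈ ℝ. If λ > liminf_{t→+∞} ψ(t), then the sublevel set L(λ) := {x ∈ S : f(x) ≤ λ} is unbounded; if λ < liminf_{t→+∞} ψ(t), then L(λ) is compact. -/
open Filter

noncomputable section

def IsPolyFun {n : ℕ} (f : EuclideanSpace ℝ (Fin n) → ℝ) : Prop :=
  ∃ P : MvPolynomial (Fin n) ℝ, ∀ x, f x = MvPolynomial.eval (fun i => x i) P

def conSet {n l m : ℕ} (g : Fin l → EuclideanSpace ℝ (Fin n) → ℝ)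
    (h : Fin m → EuclideanSpace ℝ (Fin n) → ℝ) : Set (EuclideanSpace ℝ (Fin n)) :=
  {x | (∀ i, g i x = 0) ∧ (∀ j, 0 ≤ h j x)}

def LICQ {n l m : ℕ} (g : Fin l → EuclideanSpace ℝ (Fin n) → ℝ)
    (h : Fin m → EuclideanSpace ℝ (Fin n) → ℝ) : Prop :=
  ∀ x ∈ conSet g h, LinearIndependent ℝ
    (Sum.elim (fun i : Fin l => gradient (g i) x)
      (fun j : {j : Fin m // h j x = 0} => gradient (h j.1) x))

def criticalSet {n l m : ℕ} (f : EuclideanSpace ℝ (Fin n) → ℝ)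
    (g : Fin l → EuclideanSpace ℝ (Fin n) → ℝ)
    (h : Fin m → EuclideanSpace ℝ (Fin n) → ℝ) : Set (EuclideanSpace ℝ (Fin n)) :=
  {x | x ∈ conSet g h ∧ ∃ (lam : Fin l → ℝ) (nu : Fin m → ℝ),
    gradient f x - ∑ i, lam i • gradient (g i) x - ∑ j, nu j • gradient (h j) x = 0 ∧
    ∀ j, nu j * h j x = 0}

def tangencySet {n l m : ℕ} (f : EuclideanSpace ℝ (Fin n) → ℝ)
    (g : Fin l → EuclideanSpace ℝ (Fin n) → ℝ)
    (h : Fin m → EuclideanSpace ℝ (Fin n) → ℝ) : Set (EuclideanSpace ℝ (Fin n)) :=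
  {x | x ∈ conSet g h ∧ ∃ (κ : ℝ) (lam : Fin l → ℝ) (nu : Fin m → ℝ) (μ : ℝ),
    (κ, lam, nu, μ) ≠ 0 ∧
    κ • gradient f x - ∑ i, lam i • gradient (g i) x - ∑ j, nu j • gradient (h j) x - μ • x = 0 ∧
    ∀ j, nu j * h j x = 0}

def tangencyValues {n l m : ℕ} (f : EuclideanSpace ℝ (Fin n) → ℝ)
    (g : Fin l → EuclideanSpace ℝ (Fin n) → ℝ)
    (h : Fin m → EuclideanSpace ℝ (Fin n) → ℝ) : Set ℝ :=
  {lam | ∃ x : ℕ → EuclideanSpace ℝ (Fin n), (∀ k, x k ∈ tangencySet f g h) ∧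
    Tendsto (fun k => ‖x k‖) atTop atTop ∧ Tendsto (fun k => f (x k)) atTop (nhds lam)}

def psi {n l m : ℕ} (f : EuclideanSpace ℝ (Fin n) → ℝ)
    (g : Fin l → EuclideanSpace ℝ (Fin n) → ℝ)
    (h : Fin m → EuclideanSpace ℝ (Fin n) → ℝ) (t : ℝ) : EReal :=
  sInf ((fun x => (f x : EReal)) '' {x | x ∈ conSet g h ∧ ‖x‖ = t})

def CoerciveOn {n : ℕ} (f : EuclideanSpace ℝ (Fin n) → ℝ)
    (S : Set (EuclideanSpace ℝ (Fin n))) : Prop :=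
  ∀ x : ℕ → EuclideanSpace ℝ (Fin n), (∀ k, x k ∈ S) →
    Tendsto (fun k => ‖x k‖) atTop atTop → Tendsto (fun k => f (x k)) atTop atTop

theorem IsPolyFun.continuous {n : ℕ} {f : EuclideanSpace ℝ (Fin n) → ℝ} (hf : IsPolyFun f) :
    Continuous f := by
  obtain ⟨P, hP⟩ := hf
  rw [funext hP]
  exact (MvPolynomial.continuous_eval P).comp (by fun_prop)

theorem isClosed_conSet {n l m : ℕ} {g : Fin l → EuclideanSpace ℝ (Fin n) → ℝ}
    {h : Fin m → EuclideanSpace ℝ (Fin n) → ℝ} (hg : ∀ i, Continuous (g i))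
    (hh : ∀ j, Continuous (h j)) : IsClosed (conSet g h) := by
  simp only [conSet, Set.ofPred_and, Set.ofPred_forall]
  exact (isClosed_iInter fun i => isClosed_eq (hg i) continuous_const).inter
    (isClosed_iInter fun j => isClosed_le continuous_const (hh j))

theorem sublevel_unbounded_or_compact {n l m : ℕ} (f : EuclideanSpace ℝ (Fin n) → ℝ)
    (g : Fin l → EuclideanSpace ℝ (Fin n) → ℝ) (h : Fin m → EuclideanSpace ℝ (Fin n) → ℝ)
    (hf : IsPolyFun f) (hg : ∀ i, IsPolyFun (g i)) (hh : ∀ j, IsPolyFun (h j))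
    (hS : (conSet g h).Nonempty) (hSu : ¬ Bornology.IsBounded (conSet g h))
    (hbdd : BddBelow (f '' conSet g h)) (lam : ℝ) :
    (Filter.liminf (psi f g h) Filter.atTop < (lam : EReal) →
      ¬ Bornology.IsBounded {x | x ∈ conSet g h ∧ f x ≤ lam}) ∧
    ((lam : EReal) < Filter.liminf (psi f g h) Filter.atTop →
      IsCompact {x | x ∈ conSet g h ∧ f x ≤ lam}) := by
  constructor
  · intro hlt hb
    obtain ⟨R, hR⟩ := hb.exists_norm_le
    obtain ⟨t, ht, hRt⟩ :=
      ((frequently_lt_of_liminf_lt (by isBoundedDefault) hlt).and_eventually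
        (eventually_gt_atTop R)).exists
    obtain ⟨_, ⟨x, ⟨hxS, hxt⟩, rfl⟩, hx⟩ := sInf_lt_iff.mp ht
    have hxR := hR x ⟨hxS, (EReal.coe_lt_coe_iff.mp hx).le⟩
    linarith
  · intro hlt
    obtain ⟨R, hR⟩ :=
      eventually_atTop.mp (eventually_lt_of_lt_liminf hlt (by isBoundedDefault))
    refine Metric.isCompact_of_isClosed_isBounded ?_ ?_
    · exact (isClosed_conSet (fun i => (hg i).continuous) fun j => (hh j).continuous).inter
        (isClosed_le hf.continuous continuous_const)
    · refine isBounded_iff_forall_norm_le.mpr ⟨R, fun x hx => ?_⟩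
      by_contra! hRx
      have hpsi : psi f g h ‖x‖ ≤ (f x : EReal) := sInf_le ⟨x, ⟨hx.1, rfl⟩, rfl⟩
      have hlx := EReal.coe_lt_coe_iff.mp ((hR _ hRx.le).trans_le hpsi)
      exact hlx.not_ge hx.2
end
end

section
/- Assume f is bounded from below on S and that ψ(t) converges to a real number λ_* as t → +∞. Then the sublevel set L(λ_*) := {x ∈ S : f(x) ≤ λ_*} is compact if and only if ψ(t) > λ_* for all sufficiently large t (which, ψ being eventually monotone, means that ψ is eventually strictly decreasing to λ_*). -/
open Filter

noncomputable section

theorem lt_psi_iff {n l m : ℕ} {f : EuclideanSpace ℝ (Fin n) → ℝ}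
    {g : Fin l → EuclideanSpace ℝ (Fin n) → ℝ} {h : Fin m → EuclideanSpace ℝ (Fin n) → ℝ}
    (hf : Continuous f) (hS : IsClosed (conSet g h)) (c t : ℝ) :
    (c : EReal) < psi f g h t ↔ ∀ x ∈ conSet g h, ‖x‖ = t → c < f x := by
  constructor
  · intro hc x hx hxt
    exact EReal.coe_lt_coe_iff.1 (hc.trans_le (sInf_le ⟨x, ⟨hx, hxt⟩, rfl⟩))
  · intro H
    have hK : IsCompact {x | x ∈ conSet g h ∧ ‖x‖ = t} := by
      refine Metric.isCompact_of_isClosed_isBounded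
        (hS.inter (isClosed_eq continuous_norm continuous_const)) ?_
      exact isBounded_iff_forall_norm_le.2 ⟨t, fun x hx => hx.2.le⟩
    rcases Set.eq_empty_or_nonempty {x | x ∈ conSet g h ∧ ‖x‖ = t} with he | hne
    · simp [psi, he]
    · obtain ⟨x, hx, hmin⟩ := hK.exists_isMinOn hne hf.continuousOn
      refine (EReal.coe_lt_coe_iff.2 (H x hx.1 hx.2)).trans_le (le_sInf ?_)
      rintro _ ⟨y, hy, rfl⟩
      exact EReal.coe_le_coe_iff.2 (hmin hy)

theorem sublevel_at_limit_compact_iff {n l m : ℕ} (f : EuclideanSpace ℝ (Fin n) → ℝ)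
    (g : Fin l → EuclideanSpace ℝ (Fin n) → ℝ) (h : Fin m → EuclideanSpace ℝ (Fin n) → ℝ)
    (hf : IsPolyFun f) (hg : ∀ i, IsPolyFun (g i)) (hh : ∀ j, IsPolyFun (h j))
    (hS : (conSet g h).Nonempty) (hSu : ¬ Bornology.IsBounded (conSet g h))
    (hbdd : BddBelow (f '' conSet g h)) (lamStar : ℝ)
    (hlim : Tendsto (psi f g h) atTop (nhds (lamStar : EReal))) :
    IsCompact {x | x ∈ conSet g h ∧ f x ≤ lamStar} ↔
      ∀ᶠ t in atTop, (lamStar : EReal) < psi f g h t := by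
  have hfc := hf.continuous
  have hSc : IsClosed (conSet g h) :=
    isClosed_conSet (fun i => (hg i).continuous) fun j => (hh j).continuous
  simp only [lt_psi_iff hfc hSc]
  constructor
  · intro hK
    obtain ⟨R, hR⟩ := isBounded_iff_forall_norm_le.1 hK.isBounded
    filter_upwards [eventually_gt_atTop R] with t ht x hx hxt
    by_contra! hle
    exact (ht.trans_eq hxt.symm).not_ge (hR x ⟨hx, hle⟩)
  · intro H
    obtain ⟨T, hT⟩ := eventually_atTop.1 H
    refine Metric.isCompact_of_isClosed_isBounded
      (hSc.inter (isClosed_le hfc continuous_const)) ?_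
    refine isBounded_iff_forall_norm_le.2 ⟨T, fun x hx => ?_⟩
    by_contra! hlt
    exact (hT ‖x‖ hlt.le x hx.1 rfl).not_ge hx.2
end
end

section
/- One has liminf_{t→+∞} ψ(t) ≥ inf{f(x) : x ∈ S} (liminf and inf taken in ℝ ∪ {±∞}), and if f does not attain its infimum on S, then liminf_{t→+∞} ψ(t) = inf{f(x) : x ∈ S}. -/
open Filter

noncomputable section

theorem liminf_psi_ge_inf {n l m : ℕ} (f : EuclideanSpace ℝ (Fin n) → ℝ)
    (g : Fin l → EuclideanSpace ℝ (Fin n) → ℝ) (h : Fin m → EuclideanSpace ℝ (Fin n) → ℝ)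
    (hf : IsPolyFun f) (hg : ∀ i, IsPolyFun (g i)) (hh : ∀ j, IsPolyFun (h j))
    (hS : (conSet g h).Nonempty) (hSu : ¬ Bornology.IsBounded (conSet g h)) :
    sInf ((fun x => (f x : EReal)) '' conSet g h) ≤ Filter.liminf (psi f g h) Filter.atTop ∧
    (¬ (∃ x ∈ conSet g h, ∀ y ∈ conSet g h, f x ≤ f y) →
      Filter.liminf (psi f g h) Filter.atTop = sInf ((fun x => (f x : EReal)) '' conSet g h)) := by
  have sInf_le_psi : ∀ t, sInf ((fun x => (f x : EReal)) '' conSet g h) ≤ psi f g h t :=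
    fun t => sInf_le_sInf (Set.image_mono fun x hx => hx.1)
  have sInf_le : sInf ((fun x => (f x : EReal)) '' conSet g h) ≤ liminf (psi f g h) atTop :=
    le_liminf_of_le (by isBoundedDefault) (Eventually.of_forall sInf_le_psi)
  refine ⟨sInf_le, fun hmin => le_antisymm (not_lt.1 fun hlt => hmin ?_) sInf_le⟩
  obtain ⟨c, hc, hc'⟩ := exists_between hlt
  obtain ⟨_, ⟨x₀, hx₀, rfl⟩, hx₀c⟩ := sInf_lt_iff.1 hc
  obtain ⟨R, hR⟩ := eventually_atTop.1 (eventually_lt_of_lt_liminf hc')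
  have norm_lt : ∀ x ∈ conSet g h, (f x : EReal) ≤ c → ‖x‖ < R := fun x hx hxc =>
    not_le.1 fun hRx => absurd hxc
      (not_le.2 ((hR ‖x‖ hRx).trans_le (_root_.sInf_le ⟨x, ⟨hx, rfl⟩, rfl⟩)))
  have closed := isClosed_conSet (fun i => (hg i).continuous) fun j => (hh j).continuous
  obtain ⟨x₁, hx₁, hle⟩ := ((isCompact_closedBall (0 : EuclideanSpace ℝ (Fin n)) R).inter_left
    closed).exists_isMinOn ⟨x₀, hx₀, by simpa using (norm_lt x₀ hx₀ hx₀c.le).le⟩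
    hf.continuous.continuousOn
  refine ⟨x₁, hx₁.1, fun y hy => not_lt.1 fun hyx => ?_⟩
  have hx₁₀ : f x₁ ≤ f x₀ := hle ⟨hx₀, by simpa using (norm_lt x₀ hx₀ hx₀c.le).le⟩
  have hyc : (f y : EReal) ≤ c :=
    (EReal.coe_le_coe_iff.2 (hyx.le.trans hx₁₀)).trans hx₀c.le
  exact absurd (hle ⟨hy, by simpa using (norm_lt y hy hyc).le⟩) (not_le.2 hyx)
end
end

section
/- Assume LICQ holds on S and that f is coercive on S. Then there exist real numbers c > 0, α > 0 (α rational), and R' > 0 such that f(x) ≥ c‖x‖^α for all x ∈ S with ‖x‖ ≥ R'. -/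
open Filter

noncomputable section

open KaehlerDifferential in
theorem IsTranscendenceBasis.exists_derivation {k K ι : Type*} [Field k] [Field K] [CharZero k]
    [Algebra k K] {x : ι → K} (hx : IsTranscendenceBasis k x) (y : ι → K) :
    ∃ D : Derivation k K K, ∀ i, D (x i) = y i := by
  let φ : MvPolynomial ι k →ₐ[k] K := MvPolynomial.aeval x
  let _ : Algebra (MvPolynomial ι k) K := φ.toAlgebra
  have : IsScalarTower k (MvPolynomial ι k) K := .of_algebraMap_eq fun r => (φ.commutes r).symm
  have : FaithfulSMul (MvPolynomial ι k) K := (faithfulSMul_iff_algebraMap_injective _ _).2 hx.1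
  have hX (i : ι) : algebraMap (MvPolynomial ι k) K (.X i) = x i := MvPolynomial.aeval_X _ _
  let _ : Algebra (FractionRing (MvPolynomial ι k)) K := FractionRing.liftAlgebra _ _
  have hA : Algebra.IsAlgebraic (MvPolynomial ι k) K :=
    hx.isAlgebraic_iff.2 fun i => hX i ▸ isAlgebraic_algebraMap _
  have : Algebra.IsAlgebraic (FractionRing (MvPolynomial ι k)) K :=
    (IsFractionRing.comap_isAlgebraic_iff (A := MvPolynomial ι k)).1 hA
  have : Algebra.FormallyEtale (FractionRing (MvPolynomial ι k)) K :=
    Algebra.FormallyEtale.of_isSeparable _ _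
  have : Algebra.FormallyEtale (MvPolynomial ι k) (FractionRing (MvPolynomial ι k)) :=
    .of_isLocalization (nonZeroDivisors _)
  have : Algebra.FormallyEtale (MvPolynomial ι k) K :=
    .comp _ (FractionRing (MvPolynomial ι k)) _
  let D₀ : Derivation k (MvPolynomial ι k) K := MvPolynomial.mkDerivation k y
  let e := tensorKaehlerEquivOfFormallyEtale k (MvPolynomial ι k) K
  let L : Ω[K⁄k] →ₗ[K] K := D₀.liftKaehlerDifferential.liftBaseChange K ∘ₗ e.symm.toLinearMap
  refine ⟨L.compDer (KaehlerDifferential.D k K), fun i => ?_⟩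
  have := tensorKaehlerEquivOfFormallyEtale_symm_D_algebraMap k (MvPolynomial ι k) K (.X i)
  rw [hX] at this
  simp [L, e, this, D₀]

theorem AlgebraicIndependent.exists_derivation {k K ι : Type*} [Field k] [Field K] [CharZero k]
    [Algebra k K] {x : ι → K} (hx : AlgebraicIndependent k x) (y : ι → K) :
    ∃ D : Derivation k K K, ∀ i, D (x i) = y i := by
  obtain ⟨t, hst, ht⟩ := exists_isTranscendenceBasis_superset hx.coe_range
  obtain ⟨D, hD⟩ := ht.exists_derivation (fun a => Function.extend x y 0 a)
  refine ⟨D, fun i => ?_⟩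
  rw [hD ⟨x i, hst ⟨i, rfl⟩⟩]
  exact hx.injective.extend_apply _ _ _

theorem Derivation.apply_aeval {k A M σ : Type*} [CommRing k] [CommRing A] [AddCommGroup M]
    [Algebra k A] [Module A M] [Module k M] [IsScalarTower k A M] [Fintype σ]
    (D : Derivation k A M) (u : σ → A) (p : MvPolynomial σ k) :
    D (MvPolynomial.aeval u p) =
      ∑ i, MvPolynomial.aeval u (MvPolynomial.pderiv i p) • D (u i) := by
  classical
  induction p using MvPolynomial.induction_on with
  | C a => simp
  | add p q hp hq => simp [hp, hq, add_smul, Finset.sum_add_distrib]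
  | mul_X p i hp =>
    simp only [map_mul, MvPolynomial.aeval_X, Derivation.leibniz, hp, map_add, smul_eq_mul,
      MvPolynomial.pderiv_X, add_smul, Finset.sum_add_distrib, Finset.smul_sum, smul_smul]
    congr 1
    rw [Finset.sum_eq_single i] <;> simp +contextual [eq_comm]

theorem not_algebraicIndependent_of_jacobian_relation {k K σ ι : Type*} [Field k] [Field K]
    [CharZero k] [Algebra k K] [Fintype σ] [Fintype ι] {F G : MvPolynomial σ k}
    {q : ι → MvPolynomial σ k} {u : σ → K} {a b : K} {c : ι → K} (hab : a ≠ 0 ∨ b ≠ 0)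
    (hq : ∀ j, MvPolynomial.aeval u (q j) = 0)
    (h : ∀ i, a * MvPolynomial.aeval u (MvPolynomial.pderiv i F) +
      b * MvPolynomial.aeval u (MvPolynomial.pderiv i G) +
      ∑ j, c j * MvPolynomial.aeval u (MvPolynomial.pderiv i (q j)) = 0) :
    ¬ AlgebraicIndependent k ![MvPolynomial.aeval u F, MvPolynomial.aeval u G] := by
  intro hind
  have key (D : Derivation k K K) :
      a * D (MvPolynomial.aeval u F) + b * D (MvPolynomial.aeval u G) = 0 := by
    have hc : ∑ j, c j * D (MvPolynomial.aeval u (q j)) = 0 := by simp [hq]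
    suffices h' : a * D (MvPolynomial.aeval u F) + b * D (MvPolynomial.aeval u G) +
        ∑ j, c j * D (MvPolynomial.aeval u (q j)) = 0 by rwa [hc, add_zero] at h'
    simp only [D.apply_aeval, smul_eq_mul, Finset.mul_sum]
    rw [Finset.sum_comm, ← Finset.sum_add_distrib, ← Finset.sum_add_distrib]
    refine Finset.sum_eq_zero fun i _ => ?_
    simp only [← mul_assoc, ← Finset.sum_mul, ← add_mul, h, zero_mul]
  obtain ⟨D₁, h₁⟩ := hind.exists_derivation ![1, 0]
  obtain ⟨D₂, h₂⟩ := hind.exists_derivation ![0, 1]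
  have e₁ := key D₁
  have e₂ := key D₂
  have := h₁ 0
  have := h₁ 1
  have := h₂ 0
  have := h₂ 1
  simp_all

theorem exists_relation_of_jacobian_relation {k σ ι : Type*} [Field k] [CharZero k]
    [Fintype σ] [Fintype ι] (F G : MvPolynomial σ k) (q : ι → MvPolynomial σ k) :
    ∃ Q : MvPolynomial (Fin 2) k, Q ≠ 0 ∧ ∀ (x : σ → k) (a b : k) (c : ι → k),
      (a ≠ 0 ∨ b ≠ 0) → (∀ j, MvPolynomial.eval x (q j) = 0) →
      (∀ i, a * MvPolynomial.eval x (MvPolynomial.pderiv i F) +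
        b * MvPolynomial.eval x (MvPolynomial.pderiv i G) +
        ∑ j, c j * MvPolynomial.eval x (MvPolynomial.pderiv i (q j)) = 0) →
      MvPolynomial.eval ![MvPolynomial.eval x F, MvPolynomial.eval x G] Q = 0 := by
  classical
  let B := MvPolynomial (σ ⊕ Fin 2 ⊕ ι) k
  let X : σ → B := fun i => .X (.inl i)
  let A : Fin 2 → B := fun i => .X (.inr (.inl i))
  let C : ι → B := fun i => .X (.inr (.inr i))
  let E : σ → B := fun i => A 0 * MvPolynomial.aeval X (MvPolynomial.pderiv i F) +
        A 1 * MvPolynomial.aeval X (MvPolynomial.pderiv i G) +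
        ∑ j, C j * MvPolynomial.aeval X (MvPolynomial.pderiv i (q j))
  let I : Ideal B := Ideal.span (Set.range (fun j => MvPolynomial.aeval X (q j)) ∪ Set.range E)
  have hex (p : Ideal B) (hp : p ∈ I.minimalPrimes) : ∃ Q : MvPolynomial (Fin 2) k, Q ≠ 0 ∧
      ((A 0 ∉ p ∨ A 1 ∉ p) →
        MvPolynomial.aeval ![MvPolynomial.aeval X F, MvPolynomial.aeval X G] Q ∈ p) := by
    by_cases hA : A 0 ∉ p ∨ A 1 ∉ p
    swap
    · exact ⟨1, one_ne_zero, fun h => absurd h hA⟩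
    have : p.IsPrime := hp.1.1
    let K := FractionRing (B ⧸ p)
    let π : B →ₐ[k] K := (IsScalarTower.toAlgHom k (B ⧸ p) K).comp (Ideal.Quotient.mkₐ k p)
    have hπ (b : B) : π b = 0 ↔ b ∈ p := by
      simp [π, Ideal.Quotient.eq_zero_iff_mem]
    have hI (b : B) (hb : b ∈ (Set.range (fun j => MvPolynomial.aeval X (q j)) ∪ Set.range E)) :
        π b = 0 := (hπ b).2 (hp.1.2 (Ideal.subset_span hb))
    have hu (r : MvPolynomial σ k) : MvPolynomial.aeval (π ∘ X) r = π (MvPolynomial.aeval X r) :=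
      (MvPolynomial.comp_aeval_apply X π r).symm
    have hdep := not_algebraicIndependent_of_jacobian_relation (F := F) (G := G) (q := q)
      (u := π ∘ X) (a := π (A 0)) (b := π (A 1)) (c := π ∘ C) (by simpa [hπ] using hA)
      (fun j => by rw [hu]; exact hI _ (.inl ⟨j, rfl⟩))
      (fun i => by simpa [hu, E] using hI _ (.inr ⟨i, rfl⟩))
    rw [algebraicIndependent_iff] at hdep
    push Not at hdep
    obtain ⟨Q, hQ, hQ0⟩ := hdep
    refine ⟨Q, hQ0, fun _ => ?_⟩
    rw [← hπ, MvPolynomial.comp_aeval_apply, ← hQ]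
    congr 2
    ext i
    fin_cases i <;> simp [hu]
  choose! Q hQ0 hQ using hex
  have hfin : I.minimalPrimes.Finite := I.finite_minimalPrimes_of_isNoetherianRing
  refine ⟨∏ p ∈ hfin.toFinset, Q p, Finset.prod_ne_zero_iff.2 fun p hp => hQ0 p (by simpa using hp),
    fun x a b c hab hq hE => ?_⟩
  let φ : B →ₐ[k] k := MvPolynomial.aeval (Sum.elim x (Sum.elim ![a, b] c))
  have hφ (r : MvPolynomial σ k) : φ (MvPolynomial.aeval X r) = MvPolynomial.eval x r := by
    have hX : (fun i => φ (X i)) = x := funext fun i => MvPolynomial.aeval_X _ _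
    rw [MvPolynomial.comp_aeval_apply, hX]
    rfl
  have hφA : φ (A 0) = a ∧ φ (A 1) = b := ⟨MvPolynomial.aeval_X _ _, MvPolynomial.aeval_X _ _⟩
  have hφC (j : ι) : φ (C j) = c j := MvPolynomial.aeval_X _ _
  have hIφ : I ≤ RingHom.ker φ := by
    refine Ideal.span_le.2 ?_
    rintro _ (⟨j, rfl⟩ | ⟨i, rfl⟩)
    · simpa [hφ] using hq j
    · simpa [E, hφ, hφA, hφC] using hE i
  have : (RingHom.ker φ).IsPrime := RingHom.ker_isPrime _
  obtain ⟨p, hp, hpφ⟩ := Ideal.exists_minimalPrimes_le hIφ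
  have hAp : A 0 ∉ p ∨ A 1 ∉ p := by
    refine hab.imp (fun h hA => h ?_) (fun h hA => h ?_)
    · rw [← hφA.1]; exact hpφ hA
    · rw [← hφA.2]; exact hpφ hA
  have hzero : φ _ = 0 := hpφ (hQ p hp hAp)
  rw [map_prod]
  refine Finset.prod_eq_zero (i := p) (by simpa using hp) ?_
  have hFG : (fun i => φ (![MvPolynomial.aeval X F, MvPolynomial.aeval X G] i)) =
      ![MvPolynomial.eval x F, MvPolynomial.eval x G] := by
    ext i
    fin_cases i <;> simp [hφ]
  rw [← hzero, MvPolynomial.comp_aeval_apply, hFG]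
  rfl

theorem MvPolynomial.hasStrictFDerivAt_eval {n : ℕ} (P : MvPolynomial (Fin n) ℝ)
    (x : EuclideanSpace ℝ (Fin n)) :
    HasStrictFDerivAt (fun y : EuclideanSpace ℝ (Fin n) => MvPolynomial.eval (fun i => y i) P)
      (∑ i, MvPolynomial.eval (fun i => x i) (MvPolynomial.pderiv i P) •
        (EuclideanSpace.proj i : EuclideanSpace ℝ (Fin n) →L[ℝ] ℝ)) x := by
  classical
  induction P using MvPolynomial.induction_on with
  | C a =>
    simp only [MvPolynomial.eval_C, MvPolynomial.pderiv_C, map_zero, zero_smul,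
      Finset.sum_const_zero]
    exact hasStrictFDerivAt_const a x
  | add p q hp hq =>
    simp only [map_add, add_smul, Finset.sum_add_distrib]
    exact hp.fun_add hq
  | mul_X p i hp =>
    have hi := (EuclideanSpace.proj i : EuclideanSpace ℝ (Fin n) →L[ℝ] ℝ).hasStrictFDerivAt (x := x)
    simp only [map_mul, MvPolynomial.eval_X]
    refine (hp.fun_mul hi).congr_fderiv ?_
    ext v
    simp [Derivation.leibniz, MvPolynomial.pderiv_X, add_mul, Finset.sum_add_distrib,
      Pi.single_apply, Finset.mul_sum, apply_ite, mul_assoc]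

theorem Polynomial.exists_pos_le_abs_eval_atTop {p : Polynomial ℝ} (hp : p ≠ 0) :
    ∃ δ > 0, ∀ᶠ s in atTop, δ ≤ |p.eval s| := by
  rcases lt_or_ge 0 p.degree with hd | hd
  · exact ⟨1, one_pos, (p.abs_tendsto_atTop hd).eventually_ge_atTop 1⟩
  · rw [Polynomial.eq_C_of_degree_le_zero hd] at hp ⊢
    exact ⟨|p.coeff 0|, by simpa using hp, by simp⟩

theorem Polynomial.exists_abs_eval_le_pow (p : Polynomial ℝ) :
    ∃ M, ∀ N ≥ p.natDegree, ∀ s ≥ 1, |p.eval s| ≤ M * s ^ N := by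
  refine ⟨∑ i ∈ Finset.range (p.natDegree + 1), |p.coeff i|, fun N hN s hs => ?_⟩
  rw [Polynomial.eval_eq_sum_range, Finset.sum_mul]
  refine (Finset.abs_sum_le_sum_abs _ _).trans (Finset.sum_le_sum fun i hi => ?_)
  have hs0 : 0 ≤ s := zero_le_one.trans hs
  rw [abs_mul, abs_of_nonneg (pow_nonneg hs0 i)]
  gcongr
  have := Finset.mem_range.1 hi
  omega

theorem Polynomial.exists_le_mul_pow_of_evalEval_eq_zero {Q : Polynomial (Polynomial ℝ)}
    (hQ : Q ≠ 0) :
    ∃ (C : ℝ) (N : ℕ), 0 < C ∧ 0 < N ∧ ∀ᶠ s in atTop, ∀ t, 1 ≤ t → Q.evalEval s t = 0 →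
      t ≤ C * s ^ N := by
  obtain ⟨δ, hδ, hlead⟩ := exists_pos_le_abs_eval_atTop (Polynomial.leadingCoeff_ne_zero.2 hQ)
  choose M hM using fun j => (Q.coeff j).exists_abs_eval_le_pow
  set d := Q.natDegree with hd
  let N := (Finset.range d).sup (fun j => (Q.coeff j).natDegree) + 1
  let A := ∑ j ∈ Finset.range d, |M j|
  have hA : 0 ≤ A := Finset.sum_nonneg fun _ _ => abs_nonneg _
  refine ⟨(A + 1) / δ, N, by positivity, Nat.succ_pos _, ?_⟩
  filter_upwards [hlead, eventually_ge_atTop 1] with s hs hs1 t ht hzero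
  have ht0 : 0 < t := one_pos.trans_le ht
  have hs0 : 0 < s := one_pos.trans_le hs1
  have hsum : Q.evalEval s t = ∑ j ∈ Finset.range (d + 1), (Q.coeff j).eval s * t ^ j := by
    simp [Polynomial.evalEval, Polynomial.eval_eq_sum_range (p := Q), Polynomial.eval_finsetSum,
      ← hd]
  rw [hsum, Finset.sum_range_succ, add_comm] at hzero
  have hle : δ * t ^ d ≤ A * s ^ N * t ^ (d - 1) := by
    calc δ * t ^ d ≤ |(Q.coeff d).eval s * t ^ d| := by
          rw [abs_mul, abs_of_pos (pow_pos ht0 d)]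
          gcongr
          exact hs
      _ = |∑ j ∈ Finset.range d, (Q.coeff j).eval s * t ^ j| := by
          rw [eq_neg_of_add_eq_zero_left hzero, abs_neg]
      _ ≤ ∑ j ∈ Finset.range d, |M j| * s ^ N * t ^ (d - 1) := by
          refine (Finset.abs_sum_le_sum_abs _ _).trans (Finset.sum_le_sum fun j hj => ?_)
          rw [abs_mul, abs_of_pos (pow_pos ht0 j)]
          have hjN : (Q.coeff j).natDegree ≤ N :=
            (Finset.le_sup (f := fun j => (Q.coeff j).natDegree) hj).trans (Nat.le_succ _)
          have hjd : j ≤ d - 1 := Nat.le_sub_one_of_lt (Finset.mem_range.1 hj)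
          gcongr
          · exact (hM j N hjN s hs1).trans (by gcongr; exact le_abs_self _)
      _ = A * s ^ N * t ^ (d - 1) := by rw [← Finset.sum_mul, ← Finset.sum_mul]
  rcases Nat.eq_zero_or_pos d with h0 | hpos
  · have : A = 0 := by simp [A, h0]
    simp [h0, this] at hle
    linarith
  · rw [← Nat.sub_add_cancel hpos, pow_succ, Nat.add_sub_cancel, mul_comm (t ^ _), ← mul_assoc]
      at hle
    have h1 := le_of_mul_le_mul_right hle (pow_pos ht0 _)
    rw [div_mul_eq_mul_div, le_div_iff₀ hδ]
    nlinarith [pow_pos hs0 N]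

theorem exists_rpow_le_of_relation {Q : MvPolynomial (Fin 2) ℝ} (hQ : Q ≠ 0) :
    ∃ (c : ℝ) (α : ℚ), 0 < c ∧ 0 < α ∧ ∀ᶠ s in atTop, ∀ r, 1 ≤ r →
      MvPolynomial.eval ![s, r ^ 2] Q = 0 → c * r ^ (α : ℝ) ≤ s := by
  let e := Polynomial.Bivariate.equivMvPolynomial ℝ
  have he (P : Polynomial (Polynomial ℝ)) (s t : ℝ) :
      P.evalEval s t = MvPolynomial.eval ![s, t] (e P) := by
    have : Polynomial.aevalAeval s t =
        (MvPolynomial.aeval ![s, t] : MvPolynomial (Fin 2) ℝ →ₐ[ℝ] ℝ).comp e.toAlgHom := by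
      ext <;> simp [e]
    have := DFunLike.congr_fun this P
    rwa [Polynomial.coe_aevalAeval_eq_evalEval] at this
  obtain ⟨C, N, hC, hN, h⟩ := Polynomial.exists_le_mul_pow_of_evalEval_eq_zero
    (Q := e.symm Q) (by simpa using hQ)
  have hN0 : (N : ℝ) ≠ 0 := by positivity
  refine ⟨C⁻¹ ^ (N : ℝ)⁻¹, 2 / N, by positivity, by positivity, ?_⟩
  filter_upwards [h, eventually_ge_atTop 0] with s hs hs0 r hr hzero
  have hr0 : 0 ≤ r := zero_le_one.trans hr
  have hle := hs (r ^ 2) (one_le_pow₀ hr) (by rw [he]; simpa using hzero)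
  have hle' : C⁻¹ * r ^ 2 ≤ s ^ N := by rwa [inv_mul_le_iff₀ hC]
  calc C⁻¹ ^ (N : ℝ)⁻¹ * r ^ ((2 / N : ℚ) : ℝ) = (C⁻¹ * r ^ 2) ^ (N : ℝ)⁻¹ := by
        rw [Real.mul_rpow (by positivity) (by positivity), ← Real.rpow_natCast r 2,
          ← Real.rpow_mul hr0]
        push_cast
        rw [div_eq_mul_inv]
    _ ≤ (s ^ N) ^ (N : ℝ)⁻¹ := by gcongr
    _ = s := Real.pow_rpow_inv_natCast hs0 hN.ne'

theorem CoerciveOn.exists_forall_le {n : ℕ} {f : EuclideanSpace ℝ (Fin n) → ℝ}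
    {S : Set (EuclideanSpace ℝ (Fin n))} (hf : CoerciveOn f S) (a : ℝ) :
    ∃ R, ∀ x ∈ S, R ≤ ‖x‖ → a ≤ f x := by
  by_contra! hcon
  choose x hxS hxn hxf using fun k : ℕ => hcon k
  have ht := hf x hxS (tendsto_atTop_mono hxn tendsto_natCast_atTop_atTop)
  obtain ⟨k, hk⟩ := (ht.eventually_ge_atTop a).exists
  exact (hxf k).not_ge hk

theorem eval_sum_X_sq {n : ℕ} (x : EuclideanSpace ℝ (Fin n)) :
    MvPolynomial.eval (fun i => x i) (∑ i, MvPolynomial.X i ^ 2) = ‖x‖ ^ 2 := by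
  simp [EuclideanSpace.norm_sq_eq]

theorem LICQ.exists_multipliers_of_isMin_sphere {n l m : ℕ} {F : MvPolynomial (Fin n) ℝ}
    {p : Fin l → MvPolynomial (Fin n) ℝ} {q : Fin m → MvPolynomial (Fin n) ℝ}
    {f : EuclideanSpace ℝ (Fin n) → ℝ} {g : Fin l → EuclideanSpace ℝ (Fin n) → ℝ}
    {h : Fin m → EuclideanSpace ℝ (Fin n) → ℝ}
    (hf : ∀ x, f x = MvPolynomial.eval (fun i => x i) F)
    (hg : ∀ i x, g i x = MvPolynomial.eval (fun i => x i) (p i))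
    (hh : ∀ j x, h j x = MvPolynomial.eval (fun i => x i) (q j))
    (hlicq : LICQ g h) {x : EuclideanSpace ℝ (Fin n)} (hx : x ∈ conSet g h)
    (hmin : ∀ y ∈ conSet g h, ‖y‖ = ‖x‖ → f x ≤ f y) :
    ∃ (a b : ℝ) (c : Fin l ⊕ {j : Fin m // h j x = 0} → ℝ), (a ≠ 0 ∨ b ≠ 0) ∧
      ∀ i, a * MvPolynomial.eval (fun i => x i) (MvPolynomial.pderiv i F) +
        b * MvPolynomial.eval (fun i => x i) (MvPolynomial.pderiv i (∑ i, MvPolynomial.X i ^ 2)) +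
        ∑ j, c j * MvPolynomial.eval (fun i => x i)
          (MvPolynomial.pderiv i (Sum.elim p (fun j => q j.1) j)) = 0 := by
  classical
  let ι := Fin l ⊕ {j : Fin m // h j x = 0}
  let r : ι → MvPolynomial (Fin n) ℝ := Sum.elim p (fun j => q j.1)
  let φ : Option ι → MvPolynomial (Fin n) ℝ := fun o => o.elim (∑ i, MvPolynomial.X i ^ 2) r
  let d (P : MvPolynomial (Fin n) ℝ) : StrongDual ℝ (EuclideanSpace ℝ (Fin n)) :=
    ∑ i, MvPolynomial.eval (fun i => x i) (MvPolynomial.pderiv i P) • EuclideanSpace.proj i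
  have hd (P : MvPolynomial (Fin n) ℝ) (i : Fin n) :
      d P (EuclideanSpace.single i 1) =
        MvPolynomial.eval (fun i => x i) (MvPolynomial.pderiv i P) := by
    simp [d]
  have hgrad {u : EuclideanSpace ℝ (Fin n) → ℝ} {P : MvPolynomial (Fin n) ℝ}
      (hu : ∀ x, u x = MvPolynomial.eval (fun i => x i) P) :
      gradient u x = (InnerProductSpace.toDual ℝ _).symm (d P) := by
    rw [funext hu]
    exact (P.hasStrictFDerivAt_eval x).hasFDerivAt.hasGradientAt.gradient
  have hext : IsLocalExtrOn f {y | ∀ o, MvPolynomial.eval (fun i => y i) (φ o) =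
      MvPolynomial.eval (fun i => x i) (φ o)} x := by
    left
    have hpos : ∀ᶠ y in nhds x, ∀ j, 0 < h j x → 0 < h j y := by
      refine Filter.eventually_all.2 fun j => ?_
      by_cases hj : 0 < h j x
      · filter_upwards [(IsPolyFun.continuous ⟨q j, hh j⟩).continuousAt.eventually (lt_mem_nhds hj)]
          with y hy _ using hy
      · exact .of_forall fun y hy => absurd hy hj
    filter_upwards [self_mem_nhdsWithin, nhdsWithin_le_nhds hpos] with y hy hypos
    refine hmin y ⟨fun i => ?_, fun j => ?_⟩ ?_
    · rw [← hx.1 i, hg, hg]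
      exact hy (some (.inl i))
    · rcases (hx.2 j).eq_or_lt with hj | hj
      · rw [hj, hh, hh]
        exact (hy (some (.inr ⟨j, hj.symm⟩))).ge
      · exact (hypos j hj).le
    · have := hy none
      simp only [φ, Option.elim_none, eval_sum_X_sq] at this
      exact (pow_left_inj₀ (norm_nonneg _) (norm_nonneg _) two_ne_zero).1 this
  obtain ⟨Λ, a, hne, hsum⟩ := hext.exists_multipliers_of_hasStrictFDerivAt
    (f' := fun o => d (φ o)) (φ' := d F) (fun o => (φ o).hasStrictFDerivAt_eval x)
    (by rw [funext hf]; exact F.hasStrictFDerivAt_eval x)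
  rw [Fintype.sum_option] at hsum
  refine ⟨a, Λ none, fun j => Λ (some j), ?_, fun i => ?_⟩
  · by_contra! hab
    obtain ⟨rfl, hΛ⟩ := hab
    refine hne ?_
    have hzero : ∑ j, Λ (some j) • d (r j) = 0 := by simpa [hΛ, φ] using hsum
    have hli := Fintype.linearIndependent_iff.1 (hlicq x hx) (fun j => Λ (some j)) (by
      rw [← map_zero (InnerProductSpace.toDual ℝ (EuclideanSpace ℝ (Fin n))).symm, ← hzero,
        map_sum]
      refine Finset.sum_congr rfl fun j _ => ?_
      rw [map_smulₛₗ]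
      rcases j with j | j
      · simp [r, hgrad (hg j)]
      · simp [r, hgrad (hh j.1)])
    ext o
    · rcases o with _ | j
      · exact hΛ
      · exact hli j
    · rfl
  · have := DFunLike.congr_fun hsum (EuclideanSpace.single i 1)
    simp only [add_apply, smul_apply, sum_apply, hd, smul_eq_mul, zero_apply] at this
    refine Eq.trans ?_ this
    simp only [φ, r, Option.elim_none, Option.elim_some]
    ring

theorem exists_relation_of_isMin_sphere {n l m : ℕ} {f : EuclideanSpace ℝ (Fin n) → ℝ}
    {g : Fin l → EuclideanSpace ℝ (Fin n) → ℝ} {h : Fin m → EuclideanSpace ℝ (Fin n) → ℝ}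
    (hf : IsPolyFun f) (hg : ∀ i, IsPolyFun (g i)) (hh : ∀ j, IsPolyFun (h j))
    (hlicq : LICQ g h) :
    ∃ Q : MvPolynomial (Fin 2) ℝ, Q ≠ 0 ∧ ∀ x ∈ conSet g h,
      (∀ y ∈ conSet g h, ‖y‖ = ‖x‖ → f x ≤ f y) → MvPolynomial.eval ![f x, ‖x‖ ^ 2] Q = 0 := by
  classical
  obtain ⟨F, hF⟩ := hf
  choose p hp using hg
  choose q hq using hh
  choose Q hQ0 hQ using fun J : Fin m → Prop =>
    exists_relation_of_jacobian_relation F (∑ i, MvPolynomial.X i ^ 2)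
      (Sum.elim p (fun j : {j // J j} => q j.1))
  refine ⟨∏ J, Q J, Finset.prod_ne_zero_iff.2 fun J _ => hQ0 J, fun x hx hmin => ?_⟩
  obtain ⟨a, b, c, hab, hrel⟩ := hlicq.exists_multipliers_of_isMin_sphere hF hp hq hx hmin
  rw [map_prod]
  refine Finset.prod_eq_zero (Finset.mem_univ fun j => h j x = 0) ?_
  rw [hF, ← eval_sum_X_sq]
  refine hQ _ (fun i => x i) a b c hab ?_ fun i => ?_
  · rintro (i | j)
    · exact (hp i x).symm.trans (hx.1 i)
    · exact (hq j.1 x).symm.trans j.2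
  · convert hrel i

theorem coercive_growth_at_infinity {n l m : ℕ} (f : EuclideanSpace ℝ (Fin n) → ℝ)
    (g : Fin l → EuclideanSpace ℝ (Fin n) → ℝ) (h : Fin m → EuclideanSpace ℝ (Fin n) → ℝ)
    (hf : IsPolyFun f) (hg : ∀ i, IsPolyFun (g i)) (hh : ∀ j, IsPolyFun (h j))
    (hS : (conSet g h).Nonempty) (hSu : ¬ Bornology.IsBounded (conSet g h))
    (hlicq : LICQ g h) (hcoercive : CoerciveOn f (conSet g h)) :
    ∃ (c : ℝ) (α : ℚ) (R' : ℝ), 0 < c ∧ 0 < α ∧ 0 < R' ∧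
      ∀ x ∈ conSet g h, R' ≤ ‖x‖ → c * ‖x‖ ^ (α : ℝ) ≤ f x := by
  obtain ⟨Q, hQ0, hQ⟩ := exists_relation_of_isMin_sphere hf hg hh hlicq
  obtain ⟨c, α, hc, hα, hev⟩ := exists_rpow_le_of_relation hQ0
  obtain ⟨s₀, hs₀⟩ := eventually_atTop.1 hev
  obtain ⟨R, hR⟩ := hcoercive.exists_forall_le s₀
  refine ⟨c, α, max R 1, hc, hα, by positivity, fun x hx hxR => ?_⟩
  have hcompact : IsCompact (conSet g h ∩ Metric.sphere 0 ‖x‖) :=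
    (isCompact_sphere _ _).inter_left
      (isClosed_conSet (fun i => (hg i).continuous) fun j => (hh j).continuous)
  obtain ⟨z, ⟨hz, hzx⟩, hmin⟩ := hcompact.exists_isMinOn ⟨x, hx, by simp⟩ hf.continuous.continuousOn
  rw [mem_sphere_zero_iff_norm] at hzx
  have hrel := hQ z hz fun y hy hyz => hmin ⟨hy, by simpa [hyz] using hzx⟩
  rw [← hzx] at hxR ⊢
  exact (hs₀ _ (hR z hz ((le_max_left _ _).trans hxR)) _ ((le_max_right _ _).trans hxR) hrel).trans
    (hmin ⟨hx, by simp⟩)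
end
end
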